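/- Consider the sparse linear regression model with all quantities k=k_n, p=p_n, τ=τ_n, σ=σ_n depending on n and asymptotics as n→∞, and set μ = τ/σ. Assume k/p → 0 and (k·log p)/n → 0. If μ → ∞ and μ/√(log(p/k)) → 0 (the moderate-SNR Regime II), then the minimax risk over the SNR-aware parameter space satisfies R(Θ(k,τ), σ) / (k τ²) → 1. -/

import Mathlib

open MeasureTheory ProbabilityTheory Filter
open scoped NNReal ENNReal

noncomputable section

/-- Joint law of the data: a design matrix with i.i.d. `N(0, (1/n) I_p)` rows
(entries i.i.d. `N(0, 1/n)`) and an independent noise vector with i.i.d. `N(0,1)` entries. -/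
def model (n p : ℕ) : Measure ((Fin n → Fin p → ℝ) × (Fin n → ℝ)) :=
  (Measure.pi fun _ : Fin n => Measure.pi fun _ : Fin p => gaussianReal 0 (n : ℝ≥0)⁻¹).prod
    (Measure.pi fun _ : Fin n => gaussianReal 0 1)

/-- Expected squared-error risk `E_β ‖est(X, Xβ + σ z) − β‖₂²` of an estimator `est`
under the true parameter `β` and noise level `σ`. -/
def risk (n p : ℕ) (σ : ℝ)
    (est : (Fin n → Fin p → ℝ) × (Fin n → ℝ) → Fin p → ℝ) (β : Fin p → ℝ) : ℝ≥0∞ :=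
  ∫⁻ ω, ENNReal.ofReal
      (∑ j, (est (ω.1, fun i => (∑ l, ω.1 i l * β l) + σ * ω.2 i) j - β j) ^ 2) ∂ model n p

/-- The `ℓ₀` norm: number of nonzero coordinates. -/
def l0norm {p : ℕ} (β : Fin p → ℝ) : ℕ := (Finset.univ.filter fun j => β j ≠ 0).card

/-- The SNR-aware sparse parameter space `Θ(k, τ)`. -/
def Theta (p k : ℕ) (τ : ℝ) : Set (Fin p → ℝ) :=
  {β | l0norm β ≤ k ∧ ∑ j, β j ^ 2 ≤ k * τ ^ 2}

/-- The minimax risk `R(Θ(k,τ), σ)`: infimum over measurable estimators of the supremum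
risk over `Θ(k,τ)`. -/
def minimaxRisk (n p k : ℕ) (τ σ : ℝ) : ℝ≥0∞ :=
  ⨅ (est : (Fin n → Fin p → ℝ) × (Fin n → ℝ) → Fin p → ℝ) (_ : Measurable est),
    ⨆ β ∈ Theta p k τ, risk n p σ est β

lemma gaussianReal_shift_density (a : ℝ) :
    (gaussianReal 0 1).withDensity (fun x => ENNReal.ofReal (Real.exp (a * x - a ^ 2 / 2)))
      = gaussianReal a 1 := by
  rw [gaussianReal_of_var_ne_zero _ one_ne_zero, gaussianReal_of_var_ne_zero _ one_ne_zero,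
    ← withDensity_mul _ (measurable_gaussianPDF _ _) (by fun_prop)]
  congr 1
  funext x
  simp only [Pi.mul_apply, gaussianPDF, gaussianPDFReal]
  rw [← ENNReal.ofReal_mul (by positivity), mul_assoc, ← Real.exp_add]
  congr 3
  simp only [NNReal.coe_one]
  ring

lemma pi_gaussianReal_shift_density {ι : Type*} [Fintype ι] (a : ι → ℝ) :
    (Measure.pi fun _ : ι => gaussianReal 0 1).withDensity
        (fun z => ENNReal.ofReal (Real.exp (∑ i, a i * z i - ∑ i, a i ^ 2 / 2)))
      = (Measure.pi fun _ : ι => gaussianReal 0 1).map (fun z i => z i + a i) := by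
  have hmap : (Measure.pi fun _ : ι => gaussianReal 0 1).map (fun z i => z i + a i)
      = Measure.pi fun i : ι => gaussianReal (a i) 1 := by
    rw [Measure.pi_map_pi (f := fun i x => x + a i) (fun i => by fun_prop)]
    congr 1
    funext i
    rw [gaussianReal_map_add_const, zero_add]
  rw [hmap]
  symm
  refine Measure.pi_eq fun s hs => ?_
  set g : ι → ℝ → ℝ≥0∞ := fun i =>
    (s i).indicator fun x => ENNReal.ofReal (Real.exp (a i * x - a i ^ 2 / 2)) with hg
  have hgm : ∀ i, Measurable (g i) := fun i => (by fun_prop : Measurable fun x : ℝ =>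
    ENNReal.ofReal (Real.exp (a i * x - a i ^ 2 / 2))).indicator (hs i)
  have hbox : MeasurableSet (Set.univ.pi s) := MeasurableSet.univ_pi hs
  rw [withDensity_apply _ hbox, ← lintegral_indicator hbox]
  have hprod : ∀ z : ι → ℝ, (Set.univ.pi s).indicator (fun z : ι → ℝ =>
      ENNReal.ofReal (Real.exp (∑ i, a i * z i - ∑ i, a i ^ 2 / 2))) z = ∏ i, g i (z i) := by
    intro z
    by_cases hz : z ∈ Set.univ.pi s
    · rw [Set.indicator_of_mem hz]
      have : ∀ i, g i (z i) = ENNReal.ofReal (Real.exp (a i * z i - a i ^ 2 / 2)) := fun i =>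
        Set.indicator_of_mem (hz i trivial) _
      simp only [this]
      rw [← ENNReal.ofReal_prod_of_nonneg (fun _ _ => by positivity), ← Real.exp_sum,
        Finset.sum_sub_distrib]
    · rw [Set.indicator_of_notMem hz]
      obtain ⟨i, hi⟩ : ∃ i, z i ∉ s i := by simpa [Set.mem_univ_pi] using hz
      exact (Finset.prod_eq_zero (Finset.mem_univ i) (Set.indicator_of_notMem hi _)).symm
  simp only [hprod]
  rw [lintegral_prod_eq_prod_lintegral_of_indepFun Finset.univ (fun i (z : ι → ℝ) => g i (z i))
    (iIndepFun_pi fun i => (hgm i).aemeasurable)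
    (fun i => (hgm i).comp (measurable_pi_apply i))]
  refine Finset.prod_congr rfl fun i _ => ?_
  rw [(measurePreserving_eval (fun _ : ι => gaussianReal 0 1) i).lintegral_comp (hgm i),
    lintegral_indicator (hs i), ← withDensity_apply _ (hs i), gaussianReal_shift_density]

instance model.instIsProbabilityMeasure (n p : ℕ) : IsProbabilityMeasure (model n p) := by
  unfold model; infer_instance

/-- Translation of the noise by `μ` times column `j` of the design. -/
def columnShift {n p : ℕ} (μ : ℝ) (j : Fin p) (ω : (Fin n → Fin p → ℝ) × (Fin n → ℝ)) :
    (Fin n → Fin p → ℝ) × (Fin n → ℝ) :=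
  (ω.1, fun i => ω.2 i + μ * ω.1 i j)

/-- The logarithm of the density of the law of `columnShift μ j` with respect to `model`. -/
def logLik {n p : ℕ} (μ : ℝ) (j : Fin p) (ω : (Fin n → Fin p → ℝ) × (Fin n → ℝ)) : ℝ :=
  ∑ i, μ * ω.1 i j * ω.2 i - ∑ i, (μ * ω.1 i j) ^ 2 / 2

@[fun_prop]
lemma measurable_columnShift {n p : ℕ} (μ : ℝ) (j : Fin p) :
    Measurable (columnShift (n := n) μ j) := by
  unfold columnShift; fun_prop

@[fun_prop]
lemma measurable_logLik {n p : ℕ} (μ : ℝ) (j : Fin p) : Measurable (logLik (n := n) μ j) := by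
  unfold logLik; fun_prop

lemma lintegral_columnShift {n p : ℕ} (μ : ℝ) (j : Fin p)
    {F : (Fin n → Fin p → ℝ) × (Fin n → ℝ) → ℝ≥0∞} (hF : Measurable F) :
    ∫⁻ ω, F (columnShift μ j ω) ∂model n p
      = ∫⁻ ω, ENNReal.ofReal (Real.exp (logLik μ j ω)) * F ω ∂model n p := by
  unfold model
  rw [lintegral_prod _ (by fun_prop), lintegral_prod _ (by fun_prop)]
  refine lintegral_congr fun X => ?_
  have hFX : Measurable fun z => F (X, z) := by fun_prop
  have h := pi_gaussianReal_shift_density fun i => μ * X i j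
  calc _ = ∫⁻ z, F (X, z) ∂(Measure.pi fun _ : Fin n => gaussianReal 0 1).map
        (fun z i => z i + μ * X i j) := (lintegral_map hFX (by fun_prop)).symm
    _ = _ := by
      rw [← h, lintegral_withDensity_eq_lintegral_mul _ (by fun_prop) hFX]
      rfl

lemma lintegral_sq_gaussianReal (v : ℝ≥0) :
    ∫⁻ x, ENNReal.ofReal (x ^ 2) ∂gaussianReal 0 v = v := by
  have hint : Integrable (fun x : ℝ => x ^ 2) (gaussianReal 0 v) :=
    (memLp_id_gaussianReal 2).integrable_sq
  have hvar : ∫ x, x ^ 2 ∂gaussianReal 0 v = v := by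
    have h := variance_fun_id_gaussianReal (μ := 0) (v := v)
    rw [variance_eq_integral aemeasurable_id'] at h
    simpa using h
  rw [← ofReal_integral_eq_lintegral_ofReal hint (ae_of_all _ fun x => sq_nonneg x), hvar,
    ENNReal.ofReal_coe_nnreal]

lemma pi_gaussianReal_inner_tail {ι : Type*} [Fintype ι] (x : ι → ℝ) {c : ℝ} (hc : 0 < c) :
    (Measure.pi fun _ : ι => gaussianReal 0 1) {z | c ≤ |∑ i, x i * z i|}
      ≤ ENNReal.ofReal ((∑ i, x i ^ 2) / c ^ 2) := by
  have hL : ∀ i, MemLp (fun t : ℝ => x i * t) 2 (gaussianReal 0 1) := fun i =>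
    (memLp_id_gaussianReal 2).const_mul (x i)
  have hL' : ∀ i, MemLp (fun z : ι → ℝ => x i * z i) 2
      (Measure.pi fun _ : ι => gaussianReal 0 1) := fun i =>
    (hL i).comp_measurePreserving (measurePreserving_eval (fun _ : ι => gaussianReal 0 1) i)
  have hmean : ∫ z, (∑ i, fun z : ι → ℝ => x i * z i) z
      ∂(Measure.pi fun _ : ι => gaussianReal 0 1) = 0 := by
    simp only [Finset.sum_apply]
    rw [integral_finsetSum _ fun i _ => (hL' i).integrable one_le_two]
    refine Finset.sum_eq_zero fun i _ => ?_
    rw [integral_comp_eval (μ := fun _ : ι => gaussianReal 0 1) (f := fun t : ℝ => x i * t)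
      (hL i).aestronglyMeasurable, integral_const_mul, integral_id_gaussianReal, mul_zero]
  have hvar := variance_sum_pi (μ := fun _ : ι => gaussianReal 0 1) hL
  have h := meas_ge_le_variance_div_sq (memLp_finsetSum' Finset.univ fun i _ => hL' i) hc
  rw [hmean, hvar] at h
  have hterm : ∀ i, Var[fun t => x i * t; gaussianReal 0 1] = x i ^ 2 := fun i => by
    rw [variance_const_mul, variance_fun_id_gaussianReal]; simp
  simpa [hterm] using h

/-- The design columns with large norm or large correlation with the noise. -/
def atypicalSet (n : ℕ) {p : ℕ} (a μ : ℝ) (l : Fin p) :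
    Set ((Fin n → Fin p → ℝ) × (Fin n → ℝ)) :=
  {ω | a ≤ ∑ i, ω.1 i l ^ 2 ∨ a * μ ≤ |∑ i, ω.1 i l * ω.2 i|}

lemma measurableSet_atypicalSet (n : ℕ) {p : ℕ} (a μ : ℝ) (l : Fin p) :
    MeasurableSet (atypicalSet n a μ l) := by
  have h1 : MeasurableSet {ω : (Fin n → Fin p → ℝ) × (Fin n → ℝ) | a ≤ ∑ i, ω.1 i l ^ 2} :=
    measurableSet_le (by fun_prop) (by fun_prop)
  have h2 : MeasurableSet {ω : (Fin n → Fin p → ℝ) × (Fin n → ℝ) |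
      a * μ ≤ |∑ i, ω.1 i l * ω.2 i|} :=
    measurableSet_le (by fun_prop) (by fun_prop)
  exact h1.union h2

lemma lintegral_column_sq_le (n : ℕ) {p : ℕ} (l : Fin p) :
    ∫⁻ X, ENNReal.ofReal (∑ i, X i l ^ 2) ∂(Measure.pi fun _ : Fin n =>
      Measure.pi fun _ : Fin p => gaussianReal 0 (n : ℝ≥0)⁻¹) ≤ 1 := by
  have hterm : ∀ i : Fin n, ∫⁻ X, ENNReal.ofReal (X i l ^ 2) ∂(Measure.pi fun _ : Fin n =>
      Measure.pi fun _ : Fin p => gaussianReal 0 (n : ℝ≥0)⁻¹) = ((n : ℝ≥0)⁻¹ : ℝ≥0) := by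
    intro i
    rw [(measurePreserving_eval (fun _ : Fin n => Measure.pi fun _ : Fin p =>
        gaussianReal 0 (n : ℝ≥0)⁻¹) i).lintegral_comp
        (f := fun x : Fin p → ℝ => ENNReal.ofReal (x l ^ 2)) (by fun_prop),
      (measurePreserving_eval (fun _ : Fin p => gaussianReal 0 (n : ℝ≥0)⁻¹) l).lintegral_comp
        (f := fun x : ℝ => ENNReal.ofReal (x ^ 2)) (by fun_prop),
      lintegral_sq_gaussianReal]
  simp_rw [ENNReal.ofReal_sum_of_nonneg fun _ _ => sq_nonneg _]
  rw [lintegral_finsetSum _ fun i _ => by fun_prop]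
  simp only [hterm, Finset.sum_const, Finset.card_univ, Fintype.card_fin, nsmul_eq_mul]
  norm_cast
  exact mul_inv_le_one

lemma measureReal_atypicalSet_le (n : ℕ) {p : ℕ} {a μ : ℝ} (ha : 1 ≤ a) (hμ : 1 ≤ μ)
    (l : Fin p) : (model n p).real (atypicalSet n a μ l) ≤ 2 / a := by
  have ha0 : 0 < a := by linarith
  have hlarge : model n p {ω | a ≤ ∑ i, ω.1 i l ^ 2} ≤ ENNReal.ofReal (1 / a) := by
    have hset : {ω : (Fin n → Fin p → ℝ) × (Fin n → ℝ) | a ≤ ∑ i, ω.1 i l ^ 2}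
        ⊆ {ω | ENNReal.ofReal a ≤ ENNReal.ofReal (∑ i, ω.1 i l ^ 2)} :=
      fun ω hω => ENNReal.ofReal_le_ofReal hω
    refine (measure_mono hset).trans ((meas_ge_le_lintegral_div (by fun_prop)
      (by simpa using ha0) ENNReal.ofReal_ne_top).trans ?_)
    rw [ENNReal.ofReal_div_of_pos ha0, ENNReal.ofReal_one]
    gcongr
    unfold model
    rw [lintegral_prod _ (by fun_prop)]
    simpa using lintegral_column_sq_le n l
  have hinner : model n p {ω | a * μ ≤ |∑ i, ω.1 i l * ω.2 i|} ≤ ENNReal.ofReal (1 / a) := by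
    have hc : 0 < a * μ := by positivity
    unfold model
    rw [Measure.prod_apply (measurableSet_le (by fun_prop) (by fun_prop))]
    calc _ ≤ ∫⁻ X, ENNReal.ofReal (1 / (a * μ) ^ 2) * ENNReal.ofReal (∑ i, X i l ^ 2)
          ∂(Measure.pi fun _ : Fin n => Measure.pi fun _ : Fin p =>
            gaussianReal 0 (n : ℝ≥0)⁻¹) := by
          refine lintegral_mono fun X => ?_
          rw [← ENNReal.ofReal_mul (by positivity), one_div_mul_eq_div]
          exact pi_gaussianReal_inner_tail (fun i => X i l) hc
      _ ≤ ENNReal.ofReal (1 / (a * μ) ^ 2) * 1 := by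
          rw [lintegral_const_mul _ (by fun_prop)]
          gcongr
          exact lintegral_column_sq_le n l
      _ ≤ _ := by
          rw [mul_one]
          refine ENNReal.ofReal_le_ofReal (one_div_le_one_div_of_le ha0 ?_)
          nlinarith [mul_le_mul ha hμ zero_le_one ha0.le]
  rw [measureReal_def]
  refine ENNReal.toReal_le_of_le_ofReal (by positivity) ((measure_union_le _ _).trans
    (le_trans (add_le_add hlarge hinner) ?_))
  rw [← ENNReal.ofReal_add (by positivity) (by positivity)]
  exact ENNReal.ofReal_le_ofReal (by rw [← add_div]; norm_num)

lemma logLik_columnShift {n p : ℕ} (μ : ℝ) (j l : Fin p)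
    (ω : (Fin n → Fin p → ℝ) × (Fin n → ℝ)) :
    logLik μ l (columnShift μ j ω) = μ * ∑ i, ω.1 i l * ω.2 i
      + μ ^ 2 * ∑ i, ω.1 i l * ω.1 i j - μ ^ 2 / 2 * ∑ i, ω.1 i l ^ 2 := by
  simp only [logLik, columnShift, Finset.mul_sum, ← Finset.sum_add_distrib,
    ← Finset.sum_sub_distrib]
  exact Finset.sum_congr rfl fun i _ => by ring

lemma logLik_columnShift_sub_le {n p : ℕ} {a μ : ℝ} (hμ : 0 ≤ μ) {j l : Fin p}
    {ω : (Fin n → Fin p → ℝ) × (Fin n → ℝ)}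
    (hj : ω ∉ atypicalSet n a μ j) (hl : ω ∉ atypicalSet n a μ l) :
    logLik μ j (columnShift μ j ω) - logLik μ l (columnShift μ j ω) ≤ 4 * a * μ ^ 2 := by
  simp only [atypicalSet, Set.mem_ofPred_eq, not_or, not_le] at hj hl
  rw [logLik_columnShift, logLik_columnShift]
  have hcross : -∑ i, ω.1 i l * ω.1 i j ≤ (∑ i, ω.1 i l ^ 2 + ∑ i, ω.1 i j ^ 2) / 2 := by
    rw [← Finset.sum_neg_distrib, ← Finset.sum_add_distrib, Finset.sum_div]
    exact Finset.sum_le_sum fun i _ => by nlinarith [sq_nonneg (ω.1 i l + ω.1 i j)]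
  have hself : ∑ i, ω.1 i j * ω.1 i j = ∑ i, ω.1 i j ^ 2 :=
    Finset.sum_congr rfl fun i _ => (sq _).symm
  rw [hself]
  have h1 := mul_le_mul_of_nonneg_left (abs_lt.1 hj.2).2.le hμ
  have h2 := mul_le_mul_of_nonneg_left (abs_lt.1 hl.2).1.le hμ
  have h3 := mul_le_mul_of_nonneg_left hcross (sq_nonneg μ)
  have h4 := mul_le_mul_of_nonneg_left hj.1.le (sq_nonneg μ)
  have h5 := mul_le_mul_of_nonneg_left hl.1.le (sq_nonneg μ)
  nlinarith

/-- Posterior probability of position `j` among the columns `e`, under the uniform prior. -/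
def columnPosterior {n p : ℕ} {ι : Type*} [Fintype ι] (μ : ℝ) (e : ι → Fin p) (j : ι)
    (ω : (Fin n → Fin p → ℝ) × (Fin n → ℝ)) : ℝ :=
  Real.exp (logLik μ (e j) ω) / ∑ l, Real.exp (logLik μ (e l) ω)

@[fun_prop]
lemma measurable_columnPosterior {n p : ℕ} {ι : Type*} [Fintype ι] (μ : ℝ) (e : ι → Fin p) (j : ι) :
    Measurable (columnPosterior (n := n) μ e j) := by
  unfold columnPosterior; fun_prop

lemma columnPosterior_nonneg {n p : ℕ} {ι : Type*} [Fintype ι] (μ : ℝ) (e : ι → Fin p) (j : ι)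
    (ω : (Fin n → Fin p → ℝ) × (Fin n → ℝ)) : 0 ≤ columnPosterior μ e j ω := by
  unfold columnPosterior; positivity

lemma columnPosterior_le_one {n p : ℕ} {ι : Type*} [Fintype ι] (μ : ℝ) (e : ι → Fin p) (j : ι)
    (ω : (Fin n → Fin p → ℝ) × (Fin n → ℝ)) : columnPosterior μ e j ω ≤ 1 :=
  div_le_one_of_le₀ (Finset.single_le_sum (f := fun l => Real.exp (logLik μ (e l) ω))
    (fun _ _ => by positivity) (Finset.mem_univ j)) (by positivity)

lemma columnPosterior_columnShift_le {n p : ℕ} {ι : Type*} [Fintype ι] [Nonempty ι] {a μ : ℝ}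
    (hμ : 0 ≤ μ) (e : ι → Fin p) (j : ι) (ω : (Fin n → Fin p → ℝ) × (Fin n → ℝ)) :
    columnPosterior μ e j (columnShift μ (e j) ω) ≤ (atypicalSet n a μ (e j)).indicator 1 ω
      + 2 / Fintype.card ι * ∑ l, (atypicalSet n a μ (e l)).indicator 1 ω
      + 2 * Real.exp (4 * a * μ ^ 2) / Fintype.card ι := by
  classical
  have hm : (0 : ℝ) < Fintype.card ι := by exact_mod_cast Fintype.card_pos
  have hle1 := columnPosterior_le_one μ e j (columnShift μ (e j) ω)
  have hind : ∀ l, (0 : ℝ) ≤ (atypicalSet n a μ (e l)).indicator 1 ω := fun l =>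
    Set.indicator_nonneg (fun _ _ => zero_le_one) _
  have hexp : 0 ≤ 2 * Real.exp (4 * a * μ ^ 2) / Fintype.card ι := by positivity
  have hsum : 0 ≤ 2 / (Fintype.card ι : ℝ) * ∑ l, (atypicalSet n a μ (e l)).indicator 1 ω :=
    mul_nonneg (by positivity) (Finset.sum_nonneg fun l _ => hind l)
  by_cases hj : ω ∈ atypicalSet n a μ (e j)
  · rw [Set.indicator_of_mem hj, Pi.one_apply]
    linarith
  have hj0 := hind j
  set B := Finset.univ.filter fun l => ω ∈ atypicalSet n a μ (e l) with hB
  have hBcard : ∑ l, (atypicalSet n a μ (e l)).indicator 1 ω = (B.card : ℝ) := by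
    simp [hB, Set.indicator_apply]
  rw [hBcard] at hsum ⊢
  by_cases hmany : (Fintype.card ι : ℝ) ≤ 2 * B.card
  · have : 1 ≤ 2 / (Fintype.card ι : ℝ) * B.card := by
      rw [div_mul_eq_mul_div, le_div_iff₀ hm]; linarith
    linarith
  push Not at hmany
  have hcompl : (Bᶜ.card : ℝ) = Fintype.card ι - B.card := by
    rw [Finset.card_compl, Nat.cast_sub (Finset.card_le_univ B)]
  have hS : (Bᶜ.card : ℝ) * (Real.exp (logLik μ (e j) (columnShift μ (e j) ω))
      / Real.exp (4 * a * μ ^ 2)) ≤ ∑ l, Real.exp (logLik μ (e l) (columnShift μ (e j) ω)) := by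
    rw [← nsmul_eq_mul]
    refine (Finset.card_nsmul_le_sum Bᶜ _ _ fun l hl => ?_).trans
      (Finset.sum_le_sum_of_subset_of_nonneg (Finset.subset_univ _) fun _ _ _ => by positivity)
    have hl' : ω ∉ atypicalSet n a μ (e l) := by simpa [hB] using hl
    rw [← Real.exp_sub]
    exact Real.exp_le_exp.2 (by linarith [logLik_columnShift_sub_le hμ hj hl'])
  have hpost : columnPosterior μ e j (columnShift μ (e j) ω)
      ≤ 2 * Real.exp (4 * a * μ ^ 2) / Fintype.card ι := by
    unfold columnPosterior
    have hSpos : 0 < ∑ l, Real.exp (logLik μ (e l) (columnShift μ (e j) ω)) :=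
      Finset.sum_pos (fun _ _ => by positivity) Finset.univ_nonempty
    rw [div_le_div_iff₀ hSpos hm]
    have hE := Real.exp_pos (4 * a * μ ^ 2)
    have hw := Real.exp_pos (logLik μ (e j) (columnShift μ (e j) ω))
    rw [mul_div_assoc', div_le_iff₀ hE, hcompl] at hS
    nlinarith
  linarith

lemma lintegral_one_sub_columnPosterior_ge {n p : ℕ} {ι : Type*} [Fintype ι] [Nonempty ι]
    {a μ τ : ℝ} (ha : 1 ≤ a) (hμ : 1 ≤ μ) (e : ι → Fin p) (j : ι) :
    ENNReal.ofReal (τ ^ 2 * (1 - 6 / a - 2 * Real.exp (4 * a * μ ^ 2) / Fintype.card ι))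
      ≤ ∫⁻ ω, ENNReal.ofReal (τ ^ 2 * (1 - columnPosterior μ e j (columnShift μ (e j) ω)))
        ∂model n p := by
  have hm : (0 : ℝ) < Fintype.card ι := by exact_mod_cast Fintype.card_pos
  have hpost : Integrable (fun ω => columnPosterior μ e j (columnShift μ (e j) ω))
      (model n p) := by
    have hmeas : Measurable fun ω : (Fin n → Fin p → ℝ) × (Fin n → ℝ) =>
        columnPosterior μ e j (columnShift μ (e j) ω) := by fun_prop
    refine Integrable.of_bound hmeas.aestronglyMeasurable 1 (ae_of_all _ fun ω => ?_)
    rw [Real.norm_of_nonneg (columnPosterior_nonneg _ _ _ _)]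
    exact columnPosterior_le_one _ _ _ _
  have hint : Integrable (fun ω => τ ^ 2 * (1 - columnPosterior μ e j (columnShift μ (e j) ω)))
      (model n p) := ((integrable_const 1).sub hpost).const_mul _
  rw [← ofReal_integral_eq_lintegral_ofReal hint
    (ae_of_all _ fun ω => mul_nonneg (sq_nonneg τ)
      (sub_nonneg.2 (columnPosterior_le_one _ _ _ _)))]
  refine ENNReal.ofReal_le_ofReal ?_
  let I : ι → (Fin n → Fin p → ℝ) × (Fin n → ℝ) → ℝ := fun l =>
    (atypicalSet n a μ (e l)).indicator 1
  have hI : ∀ l, Integrable (I l) (model n p) := fun l =>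
    (integrable_const (1 : ℝ)).indicator (measurableSet_atypicalSet n a μ (e l))
  have hIle : ∀ l, ∫ ω, I l ω ∂model n p ≤ 2 / a := fun l => by
    rw [integral_indicator_one (measurableSet_atypicalSet n a μ (e l))]
    exact measureReal_atypicalSet_le n ha hμ (e l)
  have hsumI : Integrable (fun ω => ∑ l, I l ω) (model n p) :=
    integrable_finsetSum _ fun l _ => hI l
  have hbound : ∫ ω, columnPosterior μ e j (columnShift μ (e j) ω) ∂model n p
      ≤ 6 / a + 2 * Real.exp (4 * a * μ ^ 2) / Fintype.card ι := by
    have hA : Integrable (fun ω => I j ω + 2 / Fintype.card ι * ∑ l, I l ω) (model n p) :=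
      (hI j).add (hsumI.const_mul _)
    have hle : ∫ ω, columnPosterior μ e j (columnShift μ (e j) ω) ∂model n p
        ≤ ∫ ω, (I j ω + 2 / Fintype.card ι * ∑ l, I l ω
          + 2 * Real.exp (4 * a * μ ^ 2) / Fintype.card ι) ∂model n p :=
      integral_mono hpost (hA.add (integrable_const _)) fun ω =>
        columnPosterior_columnShift_le (by linarith) e j ω
    refine hle.trans ?_
    rw [integral_add hA (integrable_const _), integral_add (hI j) (hsumI.const_mul _),
      integral_const_mul, integral_finsetSum _ fun l _ => hI l, integral_const,
      probReal_univ, one_smul]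
    have hsum : ∑ l, ∫ ω, I l ω ∂model n p ≤ Fintype.card ι * (2 / a) := by
      rw [← nsmul_eq_mul]
      exact Finset.sum_le_card_nsmul _ _ _ fun l _ => hIle l
    have hmul := mul_le_mul_of_nonneg_left hsum (show 0 ≤ 2 / (Fintype.card ι : ℝ) by positivity)
    have hsimp : 2 / (Fintype.card ι : ℝ) * (Fintype.card ι * (2 / a)) = 4 / a := by
      field_simp; norm_num
    have hadd : 2 / a + 4 / a = 6 / a := by ring
    linarith [hIle j]
  rw [integral_const_mul, integral_sub (integrable_const _) hpost, integral_const,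
    probReal_univ, one_smul]
  exact mul_le_mul_of_nonneg_left (by linarith) (sq_nonneg τ)

lemma sum_mul_sq_sub_single_ge {ι : Type*} [Fintype ι] [Nonempty ι] [DecidableEq ι]
    (w g : ι → ℝ) (hw : ∀ j, 0 < w j) (τ : ℝ) :
    ∑ j, w j * (τ ^ 2 * (1 - w j / ∑ l, w l))
      ≤ ∑ j, w j * ∑ c, (g c - if c = j then τ else 0) ^ 2 := by
  set S := ∑ l, w l with hS
  have hSpos : 0 < S := Finset.sum_pos (fun j _ => hw j) Finset.univ_nonempty
  have hexpand : ∀ j, ∑ c, (g c - if c = j then τ else 0) ^ 2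
      = ∑ c, g c ^ 2 - 2 * τ * g j + τ ^ 2 := by
    intro j
    have hterm : ∀ c, (g c - if c = j then τ else 0) ^ 2
        = g c ^ 2 + if c = j then τ ^ 2 - 2 * τ * g c else 0 := by
      intro c; split_ifs <;> ring
    simp only [hterm, Finset.sum_add_distrib, Finset.sum_ite_eq', Finset.mem_univ, if_true]
    ring
  have hdiff : ∑ j, w j * ∑ c, (g c - if c = j then τ else 0) ^ 2
      - ∑ j, w j * (τ ^ 2 * (1 - w j / S)) = S * ∑ j, (g j - τ * (w j / S)) ^ 2 := by
    have hlhs : ∑ j, w j * ∑ c, (g c - if c = j then τ else 0) ^ 2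
        = S * ∑ c, g c ^ 2 + ∑ j, w j * (τ ^ 2 - 2 * τ * g j) := by
      rw [hS, Finset.sum_mul, ← Finset.sum_add_distrib]
      exact Finset.sum_congr rfl fun j _ => by rw [hexpand]; ring
    rw [hlhs, Finset.mul_sum, Finset.mul_sum, ← Finset.sum_add_distrib, ← Finset.sum_sub_distrib]
    refine Finset.sum_congr rfl fun j _ => ?_
    field_simp
    ring
  have hnonneg : 0 ≤ S * ∑ j, (g j - τ * (w j / S)) ^ 2 :=
    mul_nonneg hSpos.le (Finset.sum_nonneg fun _ _ => sq_nonneg _)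
  linarith

lemma sum_lintegral_spike_loss_ge {n p : ℕ} {ι : Type*} [Fintype ι] [Nonempty ι]
    [DecidableEq ι] {a μ τ : ℝ} (ha : 1 ≤ a) (hμ : 1 ≤ μ) (e : ι → Fin p)
    {g : (Fin n → Fin p → ℝ) × (Fin n → ℝ) → ι → ℝ} (hg : Measurable g) :
    (Fintype.card ι : ℝ≥0∞) * ENNReal.ofReal
        (τ ^ 2 * (1 - 6 / a - 2 * Real.exp (4 * a * μ ^ 2) / Fintype.card ι))
      ≤ ∑ j, ∫⁻ ω, ENNReal.ofReal
          (∑ c, (g (columnShift μ (e j) ω) c - if c = j then τ else 0) ^ 2) ∂model n p := by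
  have hmeas : ∀ j, Measurable fun ω =>
      ENNReal.ofReal (∑ c, (g ω c - if c = j then τ else 0) ^ 2) := fun j => by fun_prop
  have hmeas' : ∀ j, Measurable fun ω : (Fin n → Fin p → ℝ) × (Fin n → ℝ) =>
      ENNReal.ofReal (τ ^ 2 * (1 - columnPosterior μ e j ω)) := fun j => by fun_prop
  calc _ = ∑ _j : ι, ENNReal.ofReal
        (τ ^ 2 * (1 - 6 / a - 2 * Real.exp (4 * a * μ ^ 2) / Fintype.card ι)) := by
        rw [Finset.sum_const, nsmul_eq_mul, Finset.card_univ]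
    _ ≤ ∑ j, ∫⁻ ω, ENNReal.ofReal
        (τ ^ 2 * (1 - columnPosterior μ e j (columnShift μ (e j) ω))) ∂model n p :=
        Finset.sum_le_sum fun j _ => lintegral_one_sub_columnPosterior_ge ha hμ e j
    _ = ∫⁻ ω, ∑ j, ENNReal.ofReal (Real.exp (logLik μ (e j) ω)) * ENNReal.ofReal
        (τ ^ 2 * (1 - columnPosterior μ e j ω)) ∂model n p := by
        rw [lintegral_finsetSum _ fun j _ => by fun_prop]
        exact Finset.sum_congr rfl fun j _ => lintegral_columnShift μ (e j) (hmeas' j)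
    _ ≤ ∫⁻ ω, ∑ j, ENNReal.ofReal (Real.exp (logLik μ (e j) ω)) * ENNReal.ofReal
        (∑ c, (g ω c - if c = j then τ else 0) ^ 2) ∂model n p := by
        refine lintegral_mono fun ω => ?_
        simp only [← ENNReal.ofReal_mul (Real.exp_pos _).le]
        rw [← ENNReal.ofReal_sum_of_nonneg fun j _ => mul_nonneg (Real.exp_pos _).le
            (mul_nonneg (sq_nonneg τ) (sub_nonneg.2 (columnPosterior_le_one _ _ _ _))),
          ← ENNReal.ofReal_sum_of_nonneg fun j _ => mul_nonneg (Real.exp_pos _).le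
            (Finset.sum_nonneg fun _ _ => sq_nonneg _)]
        exact ENNReal.ofReal_le_ofReal (sum_mul_sq_sub_single_ge
          (fun j => Real.exp (logLik μ (e j) ω)) (g ω) (fun _ => Real.exp_pos _) τ)
    _ = _ := by
        rw [lintegral_finsetSum _ fun j _ => by fun_prop]
        exact Finset.sum_congr rfl fun j _ => (lintegral_columnShift μ (e j) (hmeas j)).symm

/-- The vector with value `τ` at the positions `E (b, f b)`, one in each block `b`. -/
def blockSpike {p : ℕ} {κ ι : Type*} [Fintype κ] (E : κ × ι ↪ Fin p) (τ : ℝ) (f : κ → ι)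
    (q : Fin p) : ℝ :=
  open Classical in if q ∈ Finset.univ.image fun b => E (b, f b) then τ else 0

lemma blockSpike_apply {p : ℕ} {κ ι : Type*} [Fintype κ] [DecidableEq ι] (E : κ × ι ↪ Fin p)
    (τ : ℝ) (f : κ → ι) (b : κ) (c : ι) :
    blockSpike E τ f (E (b, c)) = if c = f b then τ else 0 := by
  classical
  refine if_congr ?_ rfl rfl
  simp only [Finset.mem_image, Finset.mem_univ, true_and, E.injective.eq_iff, Prod.mk.injEq]
  exact ⟨by rintro ⟨_, rfl, rfl⟩; rfl, fun h => ⟨b, rfl, h.symm⟩⟩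

lemma sum_mul_blockSpike {p : ℕ} {κ ι : Type*} [Fintype κ] (E : κ × ι ↪ Fin p)
    (τ : ℝ) (f : κ → ι) (x : Fin p → ℝ) :
    ∑ q, x q * blockSpike E τ f q = ∑ b, x (E (b, f b)) * τ := by
  classical
  simp only [blockSpike, mul_ite, mul_zero, Finset.sum_ite_mem, Finset.univ_inter]
  refine Finset.sum_image fun b _ b' _ h => ?_
  exact (Prod.mk.inj (E.injective h)).1

lemma blockSpike_mem_Theta {p : ℕ} {κ ι : Type*} [Fintype κ] (E : κ × ι ↪ Fin p)
    (τ : ℝ) (f : κ → ι) : blockSpike E τ f ∈ Theta p (Fintype.card κ) τ := by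
  classical
  constructor
  · refine (Finset.card_le_card fun q hq => ?_).trans
      (Finset.card_image_le (s := Finset.univ) (f := fun b => E (b, f b)))
    by_contra h
    exact (Finset.mem_filter.1 hq).2 (if_neg h)
  · simp_rw [sq (blockSpike E τ f _)]
    rw [sum_mul_blockSpike E τ f]
    refine le_of_eq ?_
    have hterm : ∀ b, blockSpike E τ f (E (b, f b)) * τ = τ ^ 2 := fun b => by
      rw [blockSpike_apply, if_pos rfl, sq]
    simp only [hterm, Finset.sum_const, Finset.card_univ, nsmul_eq_mul]

lemma card_nsmul_sum_eq_sum_sum_update {κ ι M : Type*} [Fintype κ] [DecidableEq κ] [Fintype ι]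
    [AddCommMonoid M] (b : κ) (F : (κ → ι) → M) :
    Fintype.card ι • ∑ f, F f = ∑ f : κ → ι, ∑ j, F (Function.update f b j) := by
  classical
  have hinv : Function.Involutive fun q : (κ → ι) × ι => (Function.update q.1 b q.2, q.1 b) := by
    rintro ⟨f, j⟩; simp
  calc Fintype.card ι • ∑ f, F f = ∑ q : (κ → ι) × ι, F q.1 := by
        rw [Fintype.sum_prod_type, Finset.smul_sum]
        simp
    _ = ∑ q : (κ → ι) × ι, F (Function.update q.1 b q.2) :=
        (Equiv.sum_comp hinv.toPerm fun q : (κ → ι) × ι => F q.1).symm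
    _ = _ := Fintype.sum_prod_type _

lemma risk_blockSpike_ge {n p : ℕ} {κ ι : Type*} [Fintype κ] [Fintype ι] [DecidableEq ι]
    (E : κ × ι ↪ Fin p) (τ σ : ℝ)
    {est : (Fin n → Fin p → ℝ) × (Fin n → ℝ) → Fin p → ℝ} (hest : Measurable est)
    (f : κ → ι) :
    ∑ b, ∫⁻ ω, ENNReal.ofReal (∑ c, (est (ω.1, fun i => ∑ b', ω.1 i (E (b', f b')) * τ
        + σ * ω.2 i) (E (b, c)) - if c = f b then τ else 0) ^ 2) ∂model n p
      ≤ risk n p σ est (blockSpike E τ f) := by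
  rw [← lintegral_finsetSum _ fun b _ => by fun_prop]
  unfold risk
  refine lintegral_mono fun ω => ?_
  rw [← ENNReal.ofReal_sum_of_nonneg fun b _ => Finset.sum_nonneg fun c _ => sq_nonneg _]
  refine ENNReal.ofReal_le_ofReal ?_
  simp only [sum_mul_blockSpike]
  set d : Fin p → ℝ := est (ω.1, fun i => ∑ b', ω.1 i (E (b', f b')) * τ + σ * ω.2 i) with hd
  calc _ = ∑ q : κ × ι, (d (E q) - blockSpike E τ f (E q)) ^ 2 := by
        simp only [Fintype.sum_prod_type, blockSpike_apply]
    _ = ∑ q ∈ Finset.univ.map E, (d q - blockSpike E τ f q) ^ 2 := by rw [Finset.sum_map]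
    _ ≤ _ := Finset.sum_le_sum_of_subset_of_nonneg (Finset.subset_univ _)
        fun _ _ _ => sq_nonneg _

lemma iSup_risk_Theta_ge {n p k m : ℕ} (hm : 0 < m) (hkm : k * m ≤ p) {a τ σ : ℝ}
    (ha : 1 ≤ a) (hσ : 0 < σ) (hμ : 1 ≤ τ / σ)
    {est : (Fin n → Fin p → ℝ) × (Fin n → ℝ) → Fin p → ℝ} (hest : Measurable est) :
    (k : ℝ≥0∞) * ENNReal.ofReal
        (τ ^ 2 * (1 - 6 / a - 2 * Real.exp (4 * a * (τ / σ) ^ 2) / m))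
      ≤ ⨆ β ∈ Theta p k τ, risk n p σ est β := by
  have : NeZero m := ⟨hm.ne'⟩
  set μ := τ / σ with hμdef
  have hστ : σ * μ = τ := by rw [hμdef]; field_simp
  set D := ENNReal.ofReal (τ ^ 2 * (1 - 6 / a - 2 * Real.exp (4 * a * μ ^ 2) / m)) with hD
  let E : Fin k × Fin m ↪ Fin p :=
    finProdFinEquiv.toEmbedding.trans (Fin.castLEEmb hkm)
  set R : (Fin k → Fin m) → Fin k → ℝ≥0∞ := fun f b =>
    ∫⁻ ω, ENNReal.ofReal (∑ c, (est (ω.1, fun i => ∑ b', ω.1 i (E (b', f b')) * τ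
        + σ * ω.2 i) (E (b, c)) - if c = f b then τ else 0) ^ 2) ∂model n p with hR
  have hblock : ∀ f b, (m : ℝ≥0∞) * D ≤ ∑ j, R (Function.update f b j) b := by
    intro f b
    set g : (Fin n → Fin p → ℝ) × (Fin n → ℝ) → Fin m → ℝ := fun ω c =>
      est (ω.1, fun i => ∑ b' ∈ Finset.univ.erase b, ω.1 i (E (b', f b')) * τ
        + σ * ω.2 i) (E (b, c)) with hg
    have hgm : Measurable g := by fun_prop
    have h := sum_lintegral_spike_loss_ge (τ := τ) ha hμ (fun j => E (b, j)) hgm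
    rw [Fintype.card_fin] at h
    refine h.trans_eq (Finset.sum_congr rfl fun j _ => ?_)
    simp only [hR, Function.update_self]
    refine lintegral_congr fun ω => ?_
    have hdata : ∀ i, ∑ b', ω.1 i (E (b', Function.update f b j b')) * τ + σ * ω.2 i
        = ∑ b' ∈ Finset.univ.erase b, ω.1 i (E (b', f b')) * τ
          + σ * (ω.2 i + μ * ω.1 i (E (b, j))) := by
      intro i
      rw [← Finset.add_sum_erase _ _ (Finset.mem_univ b), Function.update_self,
        Finset.sum_congr rfl fun b' hb' => by
          rw [Function.update_of_ne (Finset.ne_of_mem_erase hb')]]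
      rw [mul_add, ← mul_assoc σ μ, hστ]
      ring
    simp only [hdata]
    rfl
  have hN : ((Fintype.card (Fin k → Fin m) : ℕ) : ℝ≥0∞) ≠ 0 := by
    exact_mod_cast Fintype.card_ne_zero
  have hcol : ∀ b, (Fintype.card (Fin k → Fin m) : ℝ≥0∞) * D ≤ ∑ f, R f b := by
    intro b
    have hsum : (m : ℝ≥0∞) * ((Fintype.card (Fin k → Fin m) : ℝ≥0∞) * D)
        ≤ m * ∑ f, R f b := by
      calc _ = ∑ _f : Fin k → Fin m, (m : ℝ≥0∞) * D := by
            rw [Finset.sum_const, Finset.card_univ, nsmul_eq_mul]; ring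
        _ ≤ ∑ f, ∑ j, R (Function.update f b j) b := Finset.sum_le_sum fun f _ => hblock f b
        _ = _ := by
            rw [← card_nsmul_sum_eq_sum_sum_update b fun f => R f b, Fintype.card_fin,
              nsmul_eq_mul]
    exact (ENNReal.mul_le_mul_iff_right (by exact_mod_cast hm.ne')
      (ENNReal.natCast_ne_top m)).1 hsum
  have htotal : (Fintype.card (Fin k → Fin m) : ℝ≥0∞) * (k * D)
      ≤ Fintype.card (Fin k → Fin m) * ⨆ β ∈ Theta p k τ, risk n p σ est β := by
    calc _ = ∑ _b : Fin k, (Fintype.card (Fin k → Fin m) : ℝ≥0∞) * D := by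
          rw [Finset.sum_const, Finset.card_univ, Fintype.card_fin, nsmul_eq_mul]; ring
      _ ≤ ∑ b, ∑ f, R f b := Finset.sum_le_sum fun b _ => hcol b
      _ = ∑ f, ∑ b, R f b := Finset.sum_comm
      _ ≤ ∑ _f : Fin k → Fin m, ⨆ β ∈ Theta p k τ, risk n p σ est β := by
          refine Finset.sum_le_sum fun f _ => (risk_blockSpike_ge E τ σ hest f).trans ?_
          have hmem := blockSpike_mem_Theta E τ f
          rw [Fintype.card_fin] at hmem
          exact le_iSup₂ (f := fun β _ => risk n p σ est β) _ hmem
      _ = _ := by rw [Finset.sum_const, Finset.card_univ, nsmul_eq_mul]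
  exact (ENNReal.mul_le_mul_iff_right hN (ENNReal.natCast_ne_top _)).1 htotal

lemma minimaxRisk_le (n p k : ℕ) (τ σ : ℝ) :
    minimaxRisk n p k τ σ ≤ ENNReal.ofReal (k * τ ^ 2) := by
  refine (iInf₂_le (fun _ => 0) measurable_const).trans (iSup₂_le fun β hβ => ?_)
  simpa [risk] using ENNReal.ofReal_le_ofReal hβ.2

lemma minimaxRisk_toReal_ge {n p k m : ℕ} (hm : 0 < m) (hkm : k * m ≤ p) {a τ σ : ℝ}
    (ha : 1 ≤ a) (hσ : 0 < σ) (hμ : 1 ≤ τ / σ) :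
    k * τ ^ 2 * (1 - 6 / a - 2 * Real.exp (4 * a * (τ / σ) ^ 2) / m)
      ≤ (minimaxRisk n p k τ σ).toReal := by
  have hfin : minimaxRisk n p k τ σ ≠ ∞ :=
    ((minimaxRisk_le n p k τ σ).trans_lt ENNReal.ofReal_lt_top).ne
  rw [mul_assoc]
  refine (ENNReal.ofReal_le_iff_le_toReal hfin).1 ?_
  rw [ENNReal.ofReal_mul (Nat.cast_nonneg k), ENNReal.ofReal_natCast]
  exact le_iInf₂ fun est hest => iSup_risk_Theta_ge hm hkm ha hσ hμ hest

lemma tendsto_exp_mul_sq_div_floor {r μ : ℕ → ℝ} (hr : Tendsto r atTop atTop)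
    (hμ : Tendsto (fun n => μ n / Real.sqrt (Real.log (r n))) atTop (nhds 0)) (c : ℝ) :
    Tendsto (fun n => Real.exp (c * μ n ^ 2) / (⌊r n⌋₊ : ℝ)) atTop (nhds 0) := by
  have hsq : Tendsto (fun n => c * (μ n / Real.sqrt (Real.log (r n))) ^ 2) atTop (nhds 0) := by
    simpa using (hμ.pow 2).const_mul c
  have hlim : Tendsto (fun n => 2 * r n ^ (-(1 / 2) : ℝ)) atTop (nhds 0) := by
    simpa using ((tendsto_rpow_neg_atTop (by norm_num : (0 : ℝ) < 1 / 2)).comp hr).const_mul 2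
  refine squeeze_zero' (Eventually.of_forall fun n => by positivity) ?_ hlim
  filter_upwards [hsq.eventually_lt_const (by norm_num : (0 : ℝ) < 1 / 2),
    hr.eventually_ge_atTop 2] with n hn hrn
  have hr0 : 0 < r n := by linarith
  have hlog : 0 < Real.log (r n) := Real.log_pos (by linarith)
  have hexp : Real.exp (c * μ n ^ 2) ≤ r n ^ (1 / 2 : ℝ) := by
    rw [Real.rpow_def_of_pos hr0]
    refine Real.exp_le_exp.2 ?_
    rw [div_pow, Real.sq_sqrt hlog.le, mul_div_assoc', div_lt_iff₀ hlog] at hn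
    linarith
  have hfloor : r n / 2 ≤ (⌊r n⌋₊ : ℝ) := by linarith [Nat.lt_floor_add_one (r n)]
  calc Real.exp (c * μ n ^ 2) / (⌊r n⌋₊ : ℝ) ≤ r n ^ (1 / 2 : ℝ) / (r n / 2) := by gcongr
    _ = 2 * r n ^ (-(1 / 2) : ℝ) := by
      have hneg : (-(1 / 2) : ℝ) = 1 / 2 - 1 := by norm_num
      rw [hneg, Real.rpow_sub hr0, Real.rpow_one]
      field_simp

/-- **Theorem 2, Regime II (moderate SNR).** If `k/p → 0`, `(k log p)/n → 0`,
`μ = τ/σ → ∞` and `μ = o(√(log(p/k)))`, then `R(Θ(k,τ),σ) = k τ² (1 + o(1))`. -/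
theorem regimeII_first_order_minimax
    (k p : ℕ → ℕ) (τ σ : ℕ → ℝ)
    (hk : ∀ n, 0 < k n) (hkp : ∀ n, k n ≤ p n)
    (hτ : ∀ n, 0 < τ n) (hσ : ∀ n, 0 < σ n)
    (hkp0 : Tendsto (fun n => (k n : ℝ) / p n) atTop (nhds 0))
    (hklogp : Tendsto (fun n => (k n : ℝ) * Real.log (p n) / n) atTop (nhds 0))
    (hμ : Tendsto (fun n => τ n / σ n) atTop atTop)
    (hμo : Tendsto (fun n => (τ n / σ n) / Real.sqrt (Real.log ((p n : ℝ) / k n)))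
      atTop (nhds 0)) :
    Tendsto (fun n => (minimaxRisk n (p n) (k n) (τ n) (σ n)).toReal / (k n * τ n ^ 2))
      atTop (nhds 1) := by
  have hr : Tendsto (fun n => (p n : ℝ) / k n) atTop atTop := by
    have h : Tendsto (fun n => (k n : ℝ) / p n) atTop (nhdsWithin 0 (Set.Ioi 0)) := by
      refine tendsto_nhdsWithin_iff.2 ⟨hkp0, Eventually.of_forall fun n => ?_⟩
      have hk0 : (0 : ℝ) < k n := Nat.cast_pos.2 (hk n)
      have hp0 : (0 : ℝ) < p n := Nat.cast_pos.2 ((hk n).trans_le (hkp n))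
      exact div_pos hk0 hp0
    simpa [Function.comp_def] using tendsto_inv_nhdsGT_zero.comp h
  have hscale : ∀ n, 0 < (k n : ℝ) * τ n ^ 2 := fun n =>
    mul_pos (by exact_mod_cast hk n) (pow_pos (hτ n) 2)
  refine tendsto_order.2 ⟨fun c hc => ?_, fun c hc => Eventually.of_forall fun n => ?_⟩
  · set ε := min (1 - c) 1 with hε
    have hε0 : 0 < ε := lt_min (by linarith) one_pos
    have hε1 : ε ≤ 1 := min_le_right _ _
    have hεc : ε ≤ 1 - c := min_le_left _ _
    have ha : 1 ≤ 12 / ε := by rw [le_div_iff₀ hε0]; linarith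
    have hlim := tendsto_exp_mul_sq_div_floor hr hμo (4 * (12 / ε))
    filter_upwards [hlim.eventually_lt_const (by positivity : 0 < ε / 4),
      hμ.eventually_ge_atTop 1] with n hn hμn
    have hk0 : (0 : ℝ) < k n := by exact_mod_cast hk n
    have hm : 0 < ⌊(p n : ℝ) / k n⌋₊ :=
      Nat.floor_pos.2 ((one_le_div hk0).2 (by exact_mod_cast hkp n))
    have hkm : k n * ⌊(p n : ℝ) / k n⌋₊ ≤ p n := by
      rw [Nat.floor_div_eq_div]; exact Nat.mul_div_le _ _
    have h := minimaxRisk_toReal_ge (n := n) hm hkm ha (hσ n) hμn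
    rw [lt_div_iff₀ (hscale n)]
    refine lt_of_lt_of_le ?_ h
    rw [mul_comm c]
    refine mul_lt_mul_of_pos_left ?_ (hscale n)
    have h6 : 6 / (12 / ε) = ε / 2 := by field_simp; norm_num
    rw [h6, mul_div_assoc]
    linarith
  · refine lt_of_le_of_lt ((div_le_one (hscale n)).2 ?_) hc
    exact ENNReal.toReal_le_of_le_ofReal (hscale n).le (minimaxRisk_le _ _ _ _ _)
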